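/- The four hopping operators are related by conjugation as follows: T^(2) = (U† ⊗ I₄) T^(1) (U ⊗ I₄); T^(4) = (P ⊗ Q) (−T^(1)) (P ⊗ Q)†; and T^(3) = (U† ⊗ I₄)(P ⊗ Q) (−T^(1)) (P ⊗ Q)† (U ⊗ I₄), where P is the diagonal matrix on ℂ^{2Λ} with P|j⟩ = i^{(j mod 2)}|j⟩ and Q = S ⊗ I₂ on ℂ² ⊗ ℂ² with S = diag(1, i) the phase gate. -/

import Mathlib

open Matrix Complex

noncomputable section

/-- Electric field operator `E |j⟩ = (j - Λ)|j⟩` on `ℂ^(2Λ)` with `Λ = 2^(η-1)`. -/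
def Eop (η : ℕ) : Matrix (Fin (2 ^ η)) (Fin (2 ^ η)) ℂ :=
  Matrix.diagonal fun j => ((j : ℕ) : ℂ) - ((2 ^ (η - 1) : ℕ) : ℂ)

/-- Cyclic shift (link operator) `U |j⟩ = |j + 1 mod 2Λ⟩`. -/
def Uop (η : ℕ) : Matrix (Fin (2 ^ η)) (Fin (2 ^ η)) ℂ :=
  Matrix.of fun j k => if (j : ℕ) = ((k : ℕ) + 1) % 2 ^ η then 1 else 0

/-- `A |j⟩ = |j XOR 1⟩`. -/
def Aop (η : ℕ) : Matrix (Fin (2 ^ η)) (Fin (2 ^ η)) ℂ :=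
  Matrix.of fun j k => if (j : ℕ) = (k : ℕ) ^^^ 1 then 1 else 0

/-- `B |j⟩ = i (-1)^j |j XOR 1⟩`. -/
def Bop (η : ℕ) : Matrix (Fin (2 ^ η)) (Fin (2 ^ η)) ℂ :=
  Matrix.of fun j k => if (j : ℕ) = (k : ℕ) ^^^ 1 then I * (-1) ^ (k : ℕ) else 0

end

open scoped Kronecker

noncomputable section

/-- Pauli X. -/
def PX : Matrix (Fin 2) (Fin 2) ℂ := !![0, 1; 1, 0]
/-- Pauli Y. -/
def PY : Matrix (Fin 2) (Fin 2) ℂ := !![0, -I; I, 0]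
/-- The phase gate `S = diag(1, i)`. -/
def Sgate : Matrix (Fin 2) (Fin 2) ℂ := !![1, 0; 0, I]

/-- `G = X ⊗ X + Y ⊗ Y`. -/
def Gmat : Matrix (Fin 2 × Fin 2) (Fin 2 × Fin 2) ℂ := PX ⊗ₖ PX + PY ⊗ₖ PY
/-- `G̃ = X ⊗ Y − Y ⊗ X`. -/
def Gtmat : Matrix (Fin 2 × Fin 2) (Fin 2 × Fin 2) ℂ := PX ⊗ₖ PY - PY ⊗ₖ PX

/-- The hopping operators `T^(1), …, T^(4)` on `ℂ^{2Λ} ⊗ ℂ² ⊗ ℂ²`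
(`j = 0,…,3` stands for the paper's `j = 1,…,4`). -/
def Thop (η : ℕ) (x : ℝ) : Fin 4 → Matrix (Fin (2 ^ η) × (Fin 2 × Fin 2))
    (Fin (2 ^ η) × (Fin 2 × Fin 2)) ℂ
  | 0 => ((x : ℂ) / 4) • (Aop η ⊗ₖ Gmat)
  | 1 => ((x : ℂ) / 4) • (((Uop η)ᴴ * Aop η * Uop η) ⊗ₖ Gmat)
  | 2 => ((x : ℂ) / 4) • (((Uop η)ᴴ * Bop η * Uop η) ⊗ₖ Gtmat)
  | 3 => ((x : ℂ) / 4) • (Bop η ⊗ₖ Gtmat)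

/-- `P |j⟩ = i^{j mod 2} |j⟩` on `ℂ^{2Λ}`. -/
def Pmat (η : ℕ) : Matrix (Fin (2 ^ η)) (Fin (2 ^ η)) ℂ :=
  Matrix.diagonal fun j => I ^ ((j : ℕ) % 2)

/-- `Q = S ⊗ I₂` on `ℂ² ⊗ ℂ²`. -/
def Qmat : Matrix (Fin 2 × Fin 2) (Fin 2 × Fin 2) ℂ :=
  Sgate ⊗ₖ (1 : Matrix (Fin 2) (Fin 2) ℂ)

end

/-- Conjugating the bit flip `A` by the phases `P` gives `B`. -/
theorem Pmat_mul_Aop_mul_conjTranspose (η : ℕ) : Pmat η * Aop η * (Pmat η)ᴴ = Bop η := by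
  ext j k
  simp only [Pmat, Aop, Bop, diagonal_conjTranspose, mul_diagonal, diagonal_mul, of_apply,
    Pi.star_apply]
  split_ifs with h
  · have hj : (j : ℕ) % 2 = ((k : ℕ) % 2) ^^^ 1 := by
      simpa [h] using Nat.xor_mod_two_pow (a := (k : ℕ)) (b := 1) (n := 1)
    rcases Nat.even_or_odd (k : ℕ) with hk | hk
    · simp [hj, Nat.even_iff.mp hk, hk.neg_one_pow]
    · simp [hj, Nat.odd_iff.mp hk, hk.neg_one_pow]
  · simp

/-- Conjugating `G` by the phase gate on the first qubit gives `-G̃`. -/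
theorem Qmat_mul_Gmat_mul_conjTranspose : Qmat * Gmat * Qmatᴴ = -Gtmat := by
  have hQ : Qmat = diagonal fun p : Fin 2 × Fin 2 => I ^ (p.1 : ℕ) := by
    ext ⟨a, b⟩ ⟨c, d⟩
    fin_cases a <;> fin_cases b <;> fin_cases c <;> fin_cases d <;> simp [Qmat, Sgate]
  rw [hQ]
  ext ⟨a, b⟩ ⟨c, d⟩
  simp only [diagonal_conjTranspose, mul_diagonal, diagonal_mul, Pi.star_apply]
  fin_cases a <;> fin_cases b <;> fin_cases c <;> fin_cases d <;>
    simp [Gmat, Gtmat, PX, PY] <;> ring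

/-- Conjugating `-T^(1)` by `P ⊗ Q` gives `T^(4)`. -/
theorem Thop_three_eq_conj (η : ℕ) (x : ℝ) :
    Thop η x 3 = (Pmat η ⊗ₖ Qmat) * (-Thop η x 0) * (Pmat η ⊗ₖ Qmat)ᴴ := by
  simp only [Thop, conjTranspose_kronecker, Matrix.mul_neg, Matrix.neg_mul, Matrix.mul_smul,
    Matrix.smul_mul,
    ← mul_kronecker_mul, Pmat_mul_Aop_mul_conjTranspose, Qmat_mul_Gmat_mul_conjTranspose]
  ext
  simp

/-- The four hopping operators are related by conjugation:
`T^(2) = (U† ⊗ I₄) T^(1) (U ⊗ I₄)`, `T^(4) = (P ⊗ Q)(−T^(1))(P ⊗ Q)†`, and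
`T^(3) = (U† ⊗ I₄)(P ⊗ Q)(−T^(1))(P ⊗ Q)†(U ⊗ I₄)`. -/
theorem hopping_conjugation_relations (η : ℕ) (hη : 1 ≤ η) (x : ℝ) (hx : 0 < x) :
    Thop η x 1
        = ((Uop η)ᴴ ⊗ₖ (1 : Matrix (Fin 2 × Fin 2) (Fin 2 × Fin 2) ℂ)) * Thop η x 0
            * (Uop η ⊗ₖ (1 : Matrix (Fin 2 × Fin 2) (Fin 2 × Fin 2) ℂ)) ∧
      Thop η x 3
        = (Pmat η ⊗ₖ Qmat) * (-Thop η x 0) * (Pmat η ⊗ₖ Qmat)ᴴ ∧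
      Thop η x 2
        = ((Uop η)ᴴ ⊗ₖ (1 : Matrix (Fin 2 × Fin 2) (Fin 2 × Fin 2) ℂ))
            * ((Pmat η ⊗ₖ Qmat) * (-Thop η x 0) * (Pmat η ⊗ₖ Qmat)ᴴ)
            * (Uop η ⊗ₖ (1 : Matrix (Fin 2 × Fin 2) (Fin 2 × Fin 2) ℂ)) := by
  refine ⟨?_, Thop_three_eq_conj η x, ?_⟩
  · simp only [Thop, Matrix.mul_smul, Matrix.smul_mul, ← mul_kronecker_mul, Matrix.one_mul,
      Matrix.mul_one]
  · rw [← Thop_three_eq_conj]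
    simp only [Thop, Matrix.mul_smul, Matrix.smul_mul, ← mul_kronecker_mul, Matrix.one_mul,
      Matrix.mul_one]
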